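/- Every solution of x^2 = 2^a u + v with a ≥ 2, x in the ring of integers of Q(√5), and u, v units is, up to scaling by squares of units and conjugation, one of: (a=2) (√5)^2 = 4·1 + 1 and (ε^3)^2 = 4ε^3 + 1; (a=3) 3^2 = 8·1 + 1, (5+2√5)^2 = 8ε^5 + 1, (3+2√5)^2 = 8ε^4 + 1; (a=4) (17+8√5)^2 = 16ε^9 + 1. -/

import Mathlib

open Polynomial

/-- The ring of integers `ℤ[ε]` of `ℚ(√5)`, with `ε = (1+√5)/2` a root of `X² - X - 1`. -/
noncomputable abbrev GoldRing : Type := AdjoinRoot (X ^ 2 - X - 1 : ℤ[X])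

/-- The fundamental unit `ε = (1+√5)/2`. -/
noncomputable def ε : GoldRing := AdjoinRoot.root _

/-- The conjugate `ε' = (1-√5)/2 = 1 - ε`. -/
noncomputable def ε' : GoldRing := 1 - ε

/-- `√5 = 2ε - 1` in `ℤ[ε]`; its conjugate is `-√5`. -/
noncomputable def sqrt5 : GoldRing := 2 * ε - 1

namespace GoldAux

/-- The evaluation of `ℤ[ε]` in the reals. -/
noncomputable def toReal : GoldRing →+* ℝ :=
  AdjoinRoot.lift (Int.castRingHom ℝ) Real.goldenRatio (by
    simp [Real.goldenRatio_sq])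

lemma toReal_eps : toReal ε = Real.goldenRatio := by
  unfold toReal ε
  simp

lemma eps_sq : ε ^ 2 = ε + 1 := by
  have h := AdjoinRoot.mk_self (f := (X ^ 2 - X - 1 : ℤ[X]))
  simp only [map_sub, map_pow, map_one, AdjoinRoot.mk_X] at h
  change ε ^ 2 - ε - 1 = 0 at h
  linear_combination h

lemma exists_coords (y : GoldRing) : ∃ p q : ℤ, y = p + q * ε := by
  induction y using AdjoinRoot.induction_on with
  | ih f =>
    induction f using Polynomial.induction_on with
    | C a => exact ⟨a, 0, by simp⟩
    | add f g hf hg =>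
      obtain ⟨p, q, h⟩ := hf
      obtain ⟨r, s, h'⟩ := hg
      refine ⟨p + r, q + s, ?_⟩
      rw [map_add, h, h']
      push_cast
      ring
    | monomial n a hf =>
      obtain ⟨p, q, h⟩ := hf
      refine ⟨q, p + q, ?_⟩
      rw [pow_succ X n, ← mul_assoc, map_mul, h, AdjoinRoot.mk_X]
      change ((p : GoldRing) + q * ε) * ε = _
      push_cast
      linear_combination (q : GoldRing) * eps_sq

lemma real_coords (p q : ℤ) (h : (p : ℝ) + q * Real.goldenRatio = 0) : p = 0 ∧ q = 0 := by
  have hq : q = 0 := by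
    by_contra hq
    have h1 := (Real.goldenRatio_irrational.intCast_mul hq).intCast_add p
    exact h1.ne_int 0 (by simpa using h)
  subst hq
  simpa using h

lemma coords_zero (p q : ℤ) (h : (p : GoldRing) + q * ε = 0) : p = 0 ∧ q = 0 := by
  apply real_coords
  have := congrArg toReal h
  simpa [toReal_eps] using this

lemma coords_inj {p q r s : ℤ} (h : (p : GoldRing) + q * ε = r + s * ε) : p = r ∧ q = s := by
  have := coords_zero (p - r) (q - s) (by push_cast; linear_combination h)
  omega

lemma toReal_inj : Function.Injective toReal := by
  rw [injective_iff_map_eq_zero]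
  intro y hy
  obtain ⟨p, q, rfl⟩ := exists_coords y
  obtain ⟨rfl, rfl⟩ := real_coords p q (by simpa [toReal_eps] using hy)
  simp

instance instDom : IsDomain GoldRing := toReal_inj.isDomain toReal

lemma mul_coords (p q r s : ℤ) : ((p : GoldRing) + q * ε) * (r + s * ε) =
    ((p * r + q * s : ℤ) : GoldRing) + ((p * s + q * r + q * s : ℤ) : GoldRing) * ε := by
  push_cast
  linear_combination (q * s : GoldRing) * eps_sq

lemma unit_norm {p q : ℤ} (h : IsUnit ((p : GoldRing) + q * ε)) :
    p ^ 2 + p * q - q ^ 2 = 1 ∨ p ^ 2 + p * q - q ^ 2 = -1 := by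
  obtain ⟨z, hz⟩ := h.exists_right_inv
  obtain ⟨r, s, rfl⟩ := exists_coords z
  rw [mul_coords] at hz
  obtain ⟨h1, h2⟩ := coords_inj (r := 1) (s := 0) (hz.trans (by simp))
  have : (p ^ 2 + p * q - q ^ 2) * (r ^ 2 + r * s - s ^ 2) = 1 := by
    have : (p ^ 2 + p * q - q ^ 2) * (r ^ 2 + r * s - s ^ 2) =
      (p * r + q * s) ^ 2 + (p * r + q * s) * (p * s + q * r + q * s)
        - (p * s + q * r + q * s) ^ 2 := by ring
    rw [this, h1, h2]; norm_num
  exact Int.eq_one_or_neg_one_of_mul_eq_one this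

lemma eps_unit : IsUnit ε :=
  IsUnit.of_mul_eq_one (ε - 1) (by linear_combination eps_sq)

lemma two_dvd_iff (p q : ℤ) : (2 : GoldRing) ∣ p + q * ε ↔ 2 ∣ p ∧ 2 ∣ q := by
  constructor
  · rintro ⟨z, hz⟩
    obtain ⟨r, s, rfl⟩ := exists_coords z
    have := coords_inj (r := 2 * r) (s := 2 * s) (by rw [hz]; push_cast; ring)
    exact ⟨⟨r, this.1⟩, ⟨s, this.2⟩⟩
  · rintro ⟨⟨r, rfl⟩, ⟨s, rfl⟩⟩
    exact ⟨r + s * ε, by push_cast; ring⟩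

lemma two_not_unit : ¬ IsUnit (2 : GoldRing) := by
  intro h
  have := unit_norm (p := 2) (q := 0) (by simpa using h)
  norm_num at this

lemma two_prime : Prime (2 : GoldRing) := by
  refine ⟨?_, two_not_unit, ?_⟩
  · intro h
    have := coords_zero 2 0 (by simpa using h)
    omega
  · intro y z h
    obtain ⟨p, q, rfl⟩ := exists_coords y
    obtain ⟨r, s, rfl⟩ := exists_coords z
    rw [mul_coords] at h
    rw [two_dvd_iff] at h ⊢
    rw [two_dvd_iff]
    simp only [← even_iff_two_dvd] at h ⊢
    simp only [Int.even_add, Int.even_mul] at h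
    tauto

/-- Units modulo squares of units. -/
def Good (v : GoldRing) : Prop :=
  ∃ w : GoldRing, IsUnit w ∧ (v = w ^ 2 ∨ v = -w ^ 2 ∨ v = ε * w ^ 2 ∨ v = -(ε * w ^ 2))

lemma good_mul {v : GoldRing} (h : Good v) : Good (ε * v) := by
  obtain ⟨w, hw, h | h | h | h⟩ := h
  · exact ⟨w, hw, Or.inr (Or.inr (Or.inl (by rw [h])))⟩
  · exact ⟨w, hw, Or.inr (Or.inr (Or.inr (by rw [h]; ring)))⟩
  · exact ⟨ε * w, eps_unit.mul hw, Or.inl (by rw [h]; ring)⟩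
  · exact ⟨ε * w, eps_unit.mul hw, Or.inr (Or.inl (by rw [h]; ring))⟩

lemma good_div {v : GoldRing} (h : Good (ε * v)) : Good v := by
  have hi : IsUnit (ε - 1) := IsUnit.of_mul_eq_one ε (by linear_combination eps_sq)
  obtain ⟨w, hw, h⟩ := good_mul h
  refine ⟨(ε - 1) * w, hi.mul hw, ?_⟩
  have e : (ε - 1) ^ 2 * (ε * (ε * v)) = v := by
    linear_combination (v * (ε * (ε - 1) + 1)) * eps_sq
  rcases h with h | h | h | h
  · exact Or.inl (by rw [← e, h]; ring)
  · exact Or.inr (Or.inl (by rw [← e, h]; ring))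
  · exact Or.inr (Or.inr (Or.inl (by rw [← e, h]; ring)))
  · exact Or.inr (Or.inr (Or.inr (by rw [← e, h]; ring)))

lemma good_neg {v : GoldRing} (h : Good (-v)) : Good v := by
  obtain ⟨w, hw, h | h | h | h⟩ := h
  · exact ⟨w, hw, Or.inr (Or.inl (by rw [← h]; ring))⟩
  · exact ⟨w, hw, Or.inl (by linear_combination -h)⟩
  · exact ⟨w, hw, Or.inr (Or.inr (Or.inr (by rw [← h]; ring)))⟩
  · exact ⟨w, hw, Or.inr (Or.inr (Or.inl (by linear_combination -h)))⟩

lemma good_aux (n : ℕ) : ∀ p q : ℤ, p.natAbs + q.natAbs ≤ n →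
    (p ^ 2 + p * q - q ^ 2 = 1 ∨ p ^ 2 + p * q - q ^ 2 = -1) →
    Good ((p : GoldRing) + q * ε) := by
  induction n with
  | zero =>
    intro p q hn h
    obtain rfl : p = 0 := by omega
    obtain rfl : q = 0 := by omega
    norm_num at h
  | succ n ih =>
    -- the main case
    have key : ∀ p q : ℤ, 0 < p → p.natAbs + q.natAbs ≤ n + 1 →
        (p ^ 2 + p * q - q ^ 2 = 1 ∨ p ^ 2 + p * q - q ^ 2 = -1) →
        Good ((p : GoldRing) + q * ε) := by
      intro p q hp hn h
      rcases lt_trichotomy q 0 with hq | rfl | hq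
      · have hle : -q ≤ p := by
          by_contra hlt
          rcases h with h | h <;> nlinarith
        apply good_div
        have := ih q (p + q) (by omega) (by
          rcases h with h | h
          · right; linear_combination -h
          · left; linear_combination -h)
        convert this using 1
        push_cast
        linear_combination (q : GoldRing) * eps_sq
      · have : p = 1 := by rcases h with h | h <;> nlinarith
        subst this
        exact ⟨1, isUnit_one, Or.inl (by simp)⟩
      · have hle : p ≤ q := by
          by_contra hlt
          rcases h with h | h <;> nlinarith
        have := good_mul (ih (q - p) p (by omega) (by
          rcases h with h | h
          · right; linear_combination -h
          · left; linear_combination -h))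
        convert this using 1
        push_cast
        linear_combination -(p : GoldRing) * eps_sq
    intro p q hn h
    rcases lt_trichotomy p 0 with hp | rfl | hp
    · apply good_neg
      have := key (-p) (-q) (by omega) (by omega) (by
        rcases h with h | h
        · left; linear_combination h
        · right; linear_combination h)
      convert this using 1
      push_cast
      ring
    · have : q = 1 ∨ q = -1 := by
        rcases h with h | h
        · nlinarith
        · have : (q - 1) * (q + 1) = 0 := by linarith
          rcases mul_eq_zero.mp this with h | h <;> omega
      rcases this with rfl | rfl
      · exact ⟨1, isUnit_one, Or.inr (Or.inr (Or.inl (by simp)))⟩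
      · exact ⟨1, isUnit_one, Or.inr (Or.inr (Or.inr (by simp)))⟩
    · exact key p q hp hn h

lemma good_of_unit {v : GoldRing} (h : IsUnit v) : Good v := by
  obtain ⟨p, q, rfl⟩ := exists_coords v
  exact good_aux _ p q le_rfl (unit_norm h)

lemma mod4_neg : ∀ p q r s : ZMod 4, p * p + q * q = -(r * r + s * s) →
    p * q + q * p + q * q = -(r * s + s * r + s * s) →
    ¬ (r ^ 2 + r * s - s ^ 2 = 1 ∨ r ^ 2 + r * s - s ^ 2 = -1) := by decide

lemma mod4_eps : ∀ p q r s : ZMod 4, p * p + q * q = (r * s + s * r + s * s) →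
    p * q + q * p + q * q = (r * r + s * s) + (r * s + s * r + s * s) →
    ¬ (r ^ 2 + r * s - s ^ 2 = 1 ∨ r ^ 2 + r * s - s ^ 2 = -1) := by decide

lemma mod4_neg_eps : ∀ p q r s : ZMod 4, p * p + q * q = -(r * s + s * r + s * s) →
    p * q + q * p + q * q = -((r * r + s * s) + (r * s + s * r + s * s)) →
    ¬ (r ^ 2 + r * s - s ^ 2 = 1 ∨ r ^ 2 + r * s - s ^ 2 = -1) := by decide

lemma v_square {x z v : GoldRing} (hv : IsUnit v) (h : x ^ 2 = 4 * z + v) :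
    ∃ w : GoldRing, IsUnit w ∧ v = w ^ 2 := by
  obtain ⟨w, hw, hc⟩ := good_of_unit hv
  refine ⟨w, hw, ?_⟩
  obtain ⟨p, q, rfl⟩ := exists_coords x
  obtain ⟨m, n, rfl⟩ := exists_coords z
  obtain ⟨r, s, rfl⟩ := exists_coords w
  have hN := unit_norm hw
  have hN' : ((r : ZMod 4) ^ 2 + r * s - s ^ 2 = 1 ∨ (r : ZMod 4) ^ 2 + r * s - s ^ 2 = -1) := by
    rcases hN with hN | hN
    · left; exact_mod_cast congrArg (Int.cast : ℤ → ZMod 4) hN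
    · right; exact_mod_cast congrArg (Int.cast : ℤ → ZMod 4) hN
  have h4 : (4 : ZMod 4) = 0 := by decide
  rw [sq, mul_coords] at h
  rw [sq, mul_coords] at hc
  rw [sq, mul_coords]
  rcases hc with hc | hc | hc | hc
  · exact hc
  · exfalso
    rw [hc] at h
    obtain ⟨h1, h2⟩ := coords_inj (r := 4 * m - (r * r + s * s))
      (s := 4 * n - (r * s + s * r + s * s)) (by rw [h]; push_cast; ring)
    have h1 := congrArg (Int.cast : ℤ → ZMod 4) h1
    have h2 := congrArg (Int.cast : ℤ → ZMod 4) h2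
    push_cast at h1 h2
    rw [h4] at h1 h2
    exact mod4_neg p q r s (by rw [h1]; ring) (by rw [h2]; ring) hN'
  · exfalso
    rw [hc] at h
    obtain ⟨h1, h2⟩ := coords_inj (r := 4 * m + (r * s + s * r + s * s))
      (s := 4 * n + ((r * r + s * s) + (r * s + s * r + s * s))) (by
        rw [h]; push_cast
        linear_combination (r * s + s * r + s * s : GoldRing) * eps_sq)
    have h1 := congrArg (Int.cast : ℤ → ZMod 4) h1
    have h2 := congrArg (Int.cast : ℤ → ZMod 4) h2
    push_cast at h1 h2
    rw [h4] at h1 h2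
    exact mod4_eps p q r s (by rw [h1]; ring) (by rw [h2]; ring) hN'
  · exfalso
    rw [hc] at h
    obtain ⟨h1, h2⟩ := coords_inj (r := 4 * m - (r * s + s * r + s * s))
      (s := 4 * n - ((r * r + s * s) + (r * s + s * r + s * s))) (by
        rw [h]; push_cast
        linear_combination -(r * s + s * r + s * s : GoldRing) * eps_sq)
    have h1 := congrArg (Int.cast : ℤ → ZMod 4) h1
    have h2 := congrArg (Int.cast : ℤ → ZMod 4) h2
    push_cast at h1 h2
    rw [h4] at h1 h2
    exact mod4_neg_eps p q r s (by rw [h1]; ring) (by rw [h2]; ring) hN'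

/-- The conclusion of the theorem. -/
def Sol (a : ℕ) (x u v : GoldRing) : Prop :=
    ∃ w : GoldRing, IsUnit w ∧
      ((a = 2 ∧ x = w * sqrt5 ∧ u = w ^ 2 * 1 ∧ v = w ^ 2 * 1) ∨
       (a = 2 ∧ x = w * (-sqrt5) ∧ u = w ^ 2 * 1 ∧ v = w ^ 2 * 1) ∨
       (a = 2 ∧ x = w * ε ^ 3 ∧ u = w ^ 2 * ε ^ 3 ∧ v = w ^ 2 * 1) ∨
       (a = 2 ∧ x = w * ε' ^ 3 ∧ u = w ^ 2 * ε' ^ 3 ∧ v = w ^ 2 * 1) ∨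
       (a = 3 ∧ x = w * 3 ∧ u = w ^ 2 * 1 ∧ v = w ^ 2 * 1) ∨
       (a = 3 ∧ x = w * (5 + 2 * sqrt5) ∧ u = w ^ 2 * ε ^ 5 ∧ v = w ^ 2 * 1) ∨
       (a = 3 ∧ x = w * (5 - 2 * sqrt5) ∧ u = w ^ 2 * ε' ^ 5 ∧ v = w ^ 2 * 1) ∨
       (a = 3 ∧ x = w * (3 + 2 * sqrt5) ∧ u = w ^ 2 * ε ^ 4 ∧ v = w ^ 2 * 1) ∨
       (a = 3 ∧ x = w * (3 - 2 * sqrt5) ∧ u = w ^ 2 * ε' ^ 4 ∧ v = w ^ 2 * 1) ∨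
       (a = 4 ∧ x = w * (17 + 8 * sqrt5) ∧ u = w ^ 2 * ε ^ 9 ∧ v = w ^ 2 * 1) ∨
       (a = 4 ∧ x = w * (17 - 8 * sqrt5) ∧ u = w ^ 2 * ε' ^ 9 ∧ v = w ^ 2 * 1))

lemma sol_scale {a : ℕ} {x u v z : GoldRing} (hz : IsUnit z) (h : Sol a x u v) :
    Sol a (z * x) (z ^ 2 * u) (z ^ 2 * v) := by
  obtain ⟨w, hw, h⟩ := h
  refine ⟨z * w, hz.mul hw, ?_⟩
  simp only [mul_pow, mul_assoc]
  rcases h with h | h | h | h | h | h | h | h | h | h | h <;>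
    obtain ⟨rfl, rfl, rfl, rfl⟩ := h <;> simp

lemma sol_neg {a : ℕ} {x u v : GoldRing} (h : Sol a (-x) u v) : Sol a x u v := by
  simpa using sol_scale (z := -1) isUnit_one.neg h

lemma pm_one {q m : ℤ} (h : 5 * q ^ 2 = m) (hm : m = 5) : q = 1 ∨ q = -1 := by
  have : (q - 1) * (q + 1) = 0 := by linarith
  rcases mul_eq_zero.mp this with h | h <;> omega

/-- The integer equations. -/
lemma int_core (k : ℕ) (p q : ℤ) (h1 : p ^ 2 + p * q - q ^ 2 = 1 ∨ p ^ 2 + p * q - q ^ 2 = -1)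
    (h2 : (2 ^ k * p - 1) ^ 2 + (2 ^ k * p - 1) * (2 ^ k * q) - (2 ^ k * q) ^ 2 = 1 ∨
      (2 ^ k * p - 1) ^ 2 + (2 ^ k * p - 1) * (2 ^ k * q) - (2 ^ k * q) ^ 2 = -1) :
    (k = 0 ∧ ((p = 1 ∧ q = 1) ∨ (p = 2 ∧ q = -1) ∨ (p = -1 ∧ q = 1) ∨ (p = 0 ∧ q = -1) ∨
      (p = 0 ∧ q = 1) ∨ (p = 1 ∧ q = -1))) ∨
    (k = 1 ∧ ((p = 1 ∧ q = 0) ∨ (p = 1 ∧ q = 1) ∨ (p = 2 ∧ q = -1) ∨ (p = -1 ∧ q = 1) ∨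
      (p = 0 ∧ q = -1))) ∨
    (k = 2 ∧ ((p = -3 ∧ q = 2) ∨ (p = -1 ∧ q = -2))) := by
  obtain ⟨t, ht⟩ : ∃ t, t = 2 * p + q := ⟨_, rfl⟩
  obtain ⟨n, hn⟩ : ∃ n, n = p ^ 2 + p * q - q ^ 2 := ⟨_, rfl⟩
  have hq : 5 * q ^ 2 = t ^ 2 - 4 * n := by rw [ht, hn]; ring
  have h3 : 2 ^ k * (2 ^ k * n - t) = 0 ∨ 2 ^ k * (2 ^ k * n - t) = -2 := by
    rw [ht, hn]
    rcases h2 with h2 | h2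
    · left; linear_combination h2
    · right; linear_combination h2
  rw [← hn] at h1
  clear hn h2
  match k with
  | 0 =>
    left
    refine ⟨rfl, ?_⟩
    rcases h1 with rfl | rfl <;> rcases h3 with h3 | h3
    · obtain rfl : t = 1 := by omega
      nlinarith
    · obtain rfl : t = 3 := by omega
      have := pm_one hq (by norm_num)
      omega
    · obtain rfl : t = -1 := by omega
      have := pm_one hq (by norm_num)
      omega
    · obtain rfl : t = 1 := by omega
      have := pm_one hq (by norm_num)
      omega
  | 1 =>
    right; left
    refine ⟨rfl, ?_⟩
    rcases h1 with rfl | rfl <;> rcases h3 with h3 | h3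
    · obtain rfl : t = 2 := by omega
      have : q = 0 := by nlinarith
      omega
    · obtain rfl : t = 3 := by omega
      have := pm_one hq (by norm_num)
      omega
    · obtain rfl : t = -2 := by omega
      omega
    · obtain rfl : t = -1 := by omega
      have := pm_one hq (by norm_num)
      omega
  | 2 =>
    right; right
    refine ⟨rfl, ?_⟩
    rcases h1 with rfl | rfl <;> rcases h3 with h3 | h3 <;> try omega
    · obtain rfl : t = 4 := by omega
      omega
    · obtain rfl : t = -4 := by omega
      have : (q - 2) * (q + 2) = 0 := by linarith
      rcases mul_eq_zero.mp this with h | h <;> omega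
  | k + 3 =>
    exfalso
    have h4 : (2 : ℤ) ^ (k + 3) = 8 * 2 ^ k := by ring
    rw [h4] at h3
    have h0 : (2 : ℤ) ^ k ≠ 0 := by positivity
    generalize (2 : ℤ) ^ k = e at h3 h0
    have h5 : 8 * e * n - t = 0 := by
      rcases h3 with h3 | h3
      · rcases mul_eq_zero.mp h3 with h | h
        · omega
        · exact h
      · have : 8 * (e * (8 * e * n - t)) = -2 := by linarith
        omega
    obtain rfl : t = 8 * e * n := by linarith
    have hqe : Even q := by
      have : Even (5 * q ^ 2) := ⟨32 * e ^ 2 * n ^ 2 - 2 * n, by rw [hq]; ring⟩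
      rw [Int.even_mul, Int.even_pow] at this
      rcases this with h | h
      · exact absurd h (by decide)
      · exact h.1
    obtain ⟨c, rfl⟩ := hqe
    have h6 : 5 * c ^ 2 = 8 * (2 * e ^ 2 * n ^ 2) - n := by linarith
    have h7 := congrArg (Int.cast : ℤ → ZMod 8) h6
    push_cast at h7
    have h8 : (8 : ZMod 8) = 0 := by decide
    rw [h8] at h7
    have : ∀ c : ZMod 8, 5 * c ^ 2 ≠ -1 ∧ 5 * c ^ 2 ≠ 1 := by decide
    rcases h1 with rfl | rfl
    · exact (this c).1 (by simpa using h7)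
    · exact (this c).2 (by simpa using h7)

lemma eps_pow3 : ε ^ 3 = 2 * ε + 1 := by linear_combination (ε + 1) * eps_sq
lemma eps_pow4 : ε ^ 4 = 3 * ε + 2 := by linear_combination ε * eps_pow3 + 2 * eps_sq
lemma eps_pow5 : ε ^ 5 = 5 * ε + 3 := by linear_combination ε * eps_pow4 + 3 * eps_sq
lemma eps_pow9 : ε ^ 9 = 34 * ε + 21 := by
  linear_combination (ε ^ 5) * eps_pow4 + (3 * ε + 2) * eps_pow5 + 15 * eps_sq
lemma conj_sq : ε' ^ 2 = ε' + 1 := by unfold ε'; linear_combination eps_sq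
lemma conj_pow3 : ε' ^ 3 = 2 * ε' + 1 := by linear_combination (ε' + 1) * conj_sq
lemma conj_pow4 : ε' ^ 4 = 3 * ε' + 2 := by linear_combination ε' * conj_pow3 + 2 * conj_sq
lemma conj_pow5 : ε' ^ 5 = 5 * ε' + 3 := by linear_combination ε' * conj_pow4 + 3 * conj_sq
lemma conj_pow9 : ε' ^ 9 = 34 * ε' + 21 := by
  linear_combination (ε' ^ 5) * conj_pow4 + (3 * ε' + 2) * conj_pow5 + 15 * conj_sq

lemma sol_core (k : ℕ) {b c : GoldRing} (hb : IsUnit b) (hc : IsUnit c)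
    (h : 1 + b = 2 ^ k * c) : Sol (k + 2) (1 + 2 * b) (b * c) 1 := by
  obtain ⟨p, q, rfl⟩ := exists_coords c
  obtain rfl : b = ((2 ^ k * p - 1 : ℤ) : GoldRing) + ((2 ^ k * q : ℤ) : GoldRing) * ε := by
    push_cast
    linear_combination h
  have h0 := int_core k p q (unit_norm hc) (unit_norm hb)
  clear h hb hc
  have hm : IsUnit (-1 : GoldRing) := isUnit_one.neg
  have hp : IsUnit (1 : GoldRing) := isUnit_one
  unfold Sol
  rw [eps_pow3, eps_pow4, eps_pow5, eps_pow9, conj_pow3, conj_pow4, conj_pow5, conj_pow9]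
  unfold ε' sqrt5
  have e := eps_sq
  rcases h0 with ⟨rfl, h⟩ | ⟨rfl, h⟩ | ⟨rfl, h⟩
  · rcases h with ⟨rfl, rfl⟩ | ⟨rfl, rfl⟩ | ⟨rfl, rfl⟩ | ⟨rfl, rfl⟩ | ⟨rfl, rfl⟩ | ⟨rfl, rfl⟩
    · refine ⟨1, hp, Or.inr <| Or.inr <| Or.inl ⟨rfl, ?_, ?_, ?_⟩⟩ <;> push_cast <;>
        first | ring1 | linear_combination e
    · refine ⟨1, hp, Or.inr <| Or.inr <| Or.inr <| Or.inl ⟨rfl, ?_, ?_, ?_⟩⟩ <;> push_cast <;>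
        first | ring1 | linear_combination e
    · refine ⟨-1, hm, Or.inr <| Or.inr <| Or.inr <| Or.inl ⟨rfl, ?_, ?_, ?_⟩⟩ <;> push_cast <;>
        first | ring1 | linear_combination e
    · refine ⟨-1, hm, Or.inr <| Or.inr <| Or.inl ⟨rfl, ?_, ?_, ?_⟩⟩ <;> push_cast <;>
        first | ring1 | linear_combination e
    · refine ⟨1, hp, Or.inl ⟨rfl, ?_, ?_, ?_⟩⟩ <;> push_cast <;>
        first | ring1 | linear_combination e
    · refine ⟨-1, hm, Or.inl ⟨rfl, ?_, ?_, ?_⟩⟩ <;> push_cast <;>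
        first | ring1 | linear_combination e
  · rcases h with ⟨rfl, rfl⟩ | ⟨rfl, rfl⟩ | ⟨rfl, rfl⟩ | ⟨rfl, rfl⟩ | ⟨rfl, rfl⟩
    · refine ⟨1, hp, Or.inr <| Or.inr <| Or.inr <| Or.inr <| Or.inl ⟨rfl, ?_, ?_, ?_⟩⟩ <;>
        push_cast <;> first | ring1 | linear_combination 2 * e
    · refine ⟨1, hp, Or.inr <| Or.inr <| Or.inr <| Or.inr <| Or.inr <|
        Or.inl ⟨rfl, ?_, ?_, ?_⟩⟩ <;>
        push_cast <;> first | ring1 | linear_combination 2 * e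
    · refine ⟨1, hp, Or.inr <| Or.inr <| Or.inr <| Or.inr <| Or.inr <| Or.inr <|
        Or.inl ⟨rfl, ?_, ?_, ?_⟩⟩ <;>
        push_cast <;> first | ring1 | linear_combination 2 * e
    · refine ⟨-1, hm, Or.inr <| Or.inr <| Or.inr <| Or.inr <| Or.inr <| Or.inr <| Or.inr <| Or.inr <|
        Or.inl ⟨rfl, ?_, ?_, ?_⟩⟩ <;>
        push_cast <;> first | ring1 | linear_combination 2 * e
    · refine ⟨-1, hm, Or.inr <| Or.inr <| Or.inr <| Or.inr <| Or.inr <| Or.inr <| Or.inr <|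
        Or.inl ⟨rfl, ?_, ?_, ?_⟩⟩ <;>
        push_cast <;> first | ring1 | linear_combination 2 * e
  · rcases h with ⟨rfl, rfl⟩ | ⟨rfl, rfl⟩
    · refine ⟨-1, hm, Or.inr <| Or.inr <| Or.inr <| Or.inr <| Or.inr <| Or.inr <| Or.inr <|
        Or.inr <| Or.inr <| Or.inr ⟨rfl, ?_, ?_, ?_⟩⟩ <;>
        push_cast <;> first | ring1 | linear_combination 16 * e
    · refine ⟨-1, hm, Or.inr <| Or.inr <| Or.inr <| Or.inr <| Or.inr <| Or.inr <| Or.inr <|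
        Or.inr <| Or.inr <| Or.inl ⟨rfl, ?_, ?_, ?_⟩⟩ <;>
        push_cast <;> first | ring1 | linear_combination 16 * e

lemma sol_one {a : ℕ} {y u : GoldRing} (ha : 2 ≤ a) (hu : IsUnit u)
    (h : y ^ 2 = 2 ^ a * u + 1) : Sol a y u 1 := by
  have h2 : (2 : GoldRing) ≠ 0 := two_prime.ne_zero
  obtain ⟨i, j, b, c, hij, hbc, hx, hy⟩ := mul_eq_mul_prime_pow (x := y - 1) (y := y + 1)
    (a := u) (n := a) two_prime (by linear_combination h)
  have hb : IsUnit b := isUnit_of_mul_isUnit_left (hbc ▸ hu)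
  have hc : IsUnit c := isUnit_of_mul_isUnit_right (hbc ▸ hu)
  have nd : ∀ {z : GoldRing}, IsUnit z → ¬ (2 : GoldRing) ∣ z := fun hz hd =>
    two_not_unit (isUnit_of_dvd_unit hd hz)
  match i, j with
  | 0, 0 => omega
  | 0, j + 1 =>
    exact absurd ⟨2 ^ j * c - 1, by linear_combination hy - hx⟩ (nd hb)
  | i + 1, 0 =>
    exact absurd ⟨2 ^ i * b + 1, by linear_combination hx - hy⟩ (nd hc)
  | 1, j + 1 =>
    have := sol_core j hb hc (mul_left_cancel₀ h2 (by linear_combination hy - hx))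
    obtain rfl : a = j + 2 := by omega
    have e : y = 1 + 2 * b := by linear_combination hx
    rwa [e, hbc]
  | i + 2, 1 =>
    have := sol_core (i + 1) hc.neg hb.neg (mul_left_cancel₀ h2 (by linear_combination hy - hx))
    obtain rfl : a = i + 1 + 2 := by omega
    apply sol_neg
    have e : -y = 1 + 2 * -c := by linear_combination -hy
    rw [e, hbc]
    convert this using 1
    ring
  | i + 2, j + 2 =>
    refine absurd ?_ two_not_unit
    refine IsUnit.of_mul_eq_one (2 ^ j * c - 2 ^ i * b) (mul_left_cancel₀ h2 ?_)
    linear_combination hx - hy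

end GoldAux

/-- Every solution of `x² = 2^a u + v` with `a ≥ 2` and `u, v` units of `ℤ[ε]` is,
up to scaling by the square of a unit (and taking conjugates, which are listed
explicitly), one of: `(√5)² = 4·1 + 1`, `(ε³)² = 4ε³ + 1` (for `a = 2`);
`3² = 8·1 + 1`, `(5+2√5)² = 8ε⁵ + 1`, `(3+2√5)² = 8ε⁴ + 1` (for `a = 3`);
`(17+8√5)² = 16ε⁹ + 1` (for `a = 4`). -/
theorem sq_eq_pow_two_mul_unit_add_unit (a : ℕ) (x u v : GoldRing)
    (ha : 2 ≤ a) (hu : IsUnit u) (hv : IsUnit v) (h : x ^ 2 = 2 ^ a * u + v) :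
    ∃ w : GoldRing, IsUnit w ∧
      ((a = 2 ∧ x = w * sqrt5 ∧ u = w ^ 2 * 1 ∧ v = w ^ 2 * 1) ∨
       (a = 2 ∧ x = w * (-sqrt5) ∧ u = w ^ 2 * 1 ∧ v = w ^ 2 * 1) ∨
       (a = 2 ∧ x = w * ε ^ 3 ∧ u = w ^ 2 * ε ^ 3 ∧ v = w ^ 2 * 1) ∨
       (a = 2 ∧ x = w * ε' ^ 3 ∧ u = w ^ 2 * ε' ^ 3 ∧ v = w ^ 2 * 1) ∨
       (a = 3 ∧ x = w * 3 ∧ u = w ^ 2 * 1 ∧ v = w ^ 2 * 1) ∨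
       (a = 3 ∧ x = w * (5 + 2 * sqrt5) ∧ u = w ^ 2 * ε ^ 5 ∧ v = w ^ 2 * 1) ∨
       (a = 3 ∧ x = w * (5 - 2 * sqrt5) ∧ u = w ^ 2 * ε' ^ 5 ∧ v = w ^ 2 * 1) ∨
       (a = 3 ∧ x = w * (3 + 2 * sqrt5) ∧ u = w ^ 2 * ε ^ 4 ∧ v = w ^ 2 * 1) ∨
       (a = 3 ∧ x = w * (3 - 2 * sqrt5) ∧ u = w ^ 2 * ε' ^ 4 ∧ v = w ^ 2 * 1) ∨
       (a = 4 ∧ x = w * (17 + 8 * sqrt5) ∧ u = w ^ 2 * ε ^ 9 ∧ v = w ^ 2 * 1) ∨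
       (a = 4 ∧ x = w * (17 - 8 * sqrt5) ∧ u = w ^ 2 * ε' ^ 9 ∧ v = w ^ 2 * 1)) := by
  obtain ⟨d, rfl⟩ := Nat.exists_eq_add_of_le ha
  obtain ⟨w, hw, rfl⟩ := GoldAux.v_square (z := 2 ^ d * u) hv (by rw [h]; ring)
  obtain ⟨z, hz⟩ := hw.exists_right_inv
  have hzu : IsUnit z := IsUnit.of_mul_eq_one w (by rw [mul_comm, hz])
  have := GoldAux.sol_scale hw (GoldAux.sol_one (y := z * x) (u := z ^ 2 * u) ha
    ((hzu.pow 2).mul hu) (by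
      linear_combination z ^ 2 * h + (z * w + 1) * hz))
  have e1 : w * (z * x) = x := by linear_combination x * hz
  have e2 : w ^ 2 * (z ^ 2 * u) = u := by linear_combination u * (w * z + 1) * hz
  rw [e1, e2, mul_one] at this
  exact this
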